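/- Let d ≥ 1, ϑ > 0, c ∈ ℝ^d, and let z : ℝ^d → ℝ be four times continuously differentiable with compact support. Then the integral ∫₀^∞ ( ∫_{ℝ^d} ⟨c, x⟩ ((q_{ϑs} * Δz)(x))² dx ) ds converges absolutely and equals (1/(2ϑ)) ∫_{ℝ^d} ⟨c, x⟩ |∇z(x)|² dx. -/

import Mathlib

open MeasureTheory Real Filter Topology
open scoped InnerProductSpace

noncomputable section

/-- Gaussian heat kernel `q_t(x) = (4πt)^{-d/2} exp(-|x|²/(4t))` on ℝ^d. -/
def heatK (d : ℕ) (t : ℝ) (x : EuclideanSpace ℝ (Fin d)) : ℝ :=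
  (4 * π * t) ^ (-(d : ℝ) / 2) * Real.exp (-‖x‖ ^ 2 / (4 * t))

/-- Heat semigroup acting by convolution: `e^{tΔ}u = q_t * u`. -/
def heatConv {d : ℕ} (t : ℝ) (u : EuclideanSpace ℝ (Fin d) → ℝ)
    (x : EuclideanSpace ℝ (Fin d)) : ℝ :=
  ∫ y, heatK d t (x - y) * u y

/-- `i`-th partial derivative `∂ᵢ f`. -/
def pd {d : ℕ} (i : Fin d) (f : EuclideanSpace ℝ (Fin d) → ℝ)
    (x : EuclideanSpace ℝ (Fin d)) : ℝ :=
  fderiv ℝ f x (EuclideanSpace.single i 1)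

/-- Laplacian `Δf = Σᵢ ∂ᵢ∂ᵢ f`. -/
def lap {d : ℕ} (f : EuclideanSpace ℝ (Fin d) → ℝ)
    (x : EuclideanSpace ℝ (Fin d)) : ℝ :=
  ∑ i : Fin d, pd i (pd i f) x

/-- Divergence of a vector field `div F = Σᵢ ∂ᵢ Fᵢ`. -/
def divg {d : ℕ} (F : EuclideanSpace ℝ (Fin d) → EuclideanSpace ℝ (Fin d))
    (x : EuclideanSpace ℝ (Fin d)) : ℝ :=
  ∑ i : Fin d, fderiv ℝ (fun y => F y i) x (EuclideanSpace.single i 1)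

/-- `L²` norm `(∫ u²)^{1/2}`. -/
def l2n {d : ℕ} (u : EuclideanSpace ℝ (Fin d) → ℝ) : ℝ :=
  (∫ x, (u x) ^ 2) ^ (1 / 2 : ℝ)

/-- `L¹` norm `∫ |u|`. -/
def l1n {d : ℕ} (u : EuclideanSpace ℝ (Fin d) → ℝ) : ℝ := ∫ x, |u x|

/-- `L¹∩L²` norm `‖u‖_{L¹} + ‖u‖_{L²}`. -/
def l12n {d : ℕ} (u : EuclideanSpace ℝ (Fin d) → ℝ) : ℝ := l1n u + l2n u

/-- `W²_{1,2}` norm `‖z‖_{L¹∩L²} + ‖|∇z|‖_{L¹∩L²} + ‖Δz‖_{L¹∩L²}`. -/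
def w2n {d : ℕ} (z : EuclideanSpace ℝ (Fin d) → ℝ) : ℝ :=
  l12n z + l12n (fun x => ‖gradient z x‖) + l12n (lap z)

section HeatKernel

variable {d : ℕ}

lemma integrable_exp_neg_mul_norm_sq {b : ℝ} (hb : 0 < b) :
    Integrable (fun v : EuclideanSpace ℝ (Fin d) => rexp (-b * ‖v‖ ^ 2)) := by
  apply Integrable.of_integral_ne_zero
  rw [GaussianFourier.integral_rexp_neg_mul_sq_norm hb]
  positivity

lemma integrable_norm_mul_exp_neg_mul_norm_sq {b : ℝ} (hb : 0 < b) :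
    Integrable (fun v : EuclideanSpace ℝ (Fin d) => ‖v‖ * rexp (-b * ‖v‖ ^ 2)) := by
  refine ((integrable_exp_neg_mul_norm_sq (d := d) (half_pos hb)).const_mul
    (1 + 1 / (2 * b))).mono' (by fun_prop) (ae_of_all _ fun v => ?_)
  rw [Real.norm_of_nonneg (by positivity)]
  have h1 : 1 + b / 2 * ‖v‖ ^ 2 ≤ rexp (b / 2 * ‖v‖ ^ 2) := by
    linarith [Real.add_one_le_exp (b / 2 * ‖v‖ ^ 2)]
  have h2 : ‖v‖ ≤ (1 + 1 / (2 * b)) * (1 + b / 2 * ‖v‖ ^ 2) := by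
    have h3 : ‖v‖ ≤ b / 2 * ‖v‖ ^ 2 + 1 / (2 * b) := by
      have : b / 2 * ‖v‖ ^ 2 + 1 / (2 * b) - ‖v‖ = (b * ‖v‖ - 1) ^ 2 / (2 * b) := by
        field_simp; ring
      have : 0 ≤ (b * ‖v‖ - 1) ^ 2 / (2 * b) := by positivity
      linarith
    have : 0 ≤ 1 / (2 * b) * (b / 2 * ‖v‖ ^ 2) := by positivity
    nlinarith
  have h4 : rexp (-b * ‖v‖ ^ 2) = rexp (-(b / 2 * ‖v‖ ^ 2)) * rexp (-(b / 2) * ‖v‖ ^ 2) := by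
    rw [← Real.exp_add]; ring_nf
  have h5 : rexp (b / 2 * ‖v‖ ^ 2) * rexp (-(b / 2 * ‖v‖ ^ 2)) = 1 := by
    rw [← Real.exp_add]; simp
  rw [h4, ← mul_assoc]
  gcongr
  calc ‖v‖ * rexp (-(b / 2 * ‖v‖ ^ 2))
      ≤ (1 + 1 / (2 * b)) * rexp (b / 2 * ‖v‖ ^ 2) * rexp (-(b / 2 * ‖v‖ ^ 2)) := by
        gcongr
        exact h2.trans (by gcongr)
    _ = 1 + 1 / (2 * b) := by rw [mul_assoc, h5, mul_one]

lemma heatK_nonneg {t : ℝ} (ht : 0 < t) (v : EuclideanSpace ℝ (Fin d)) : 0 ≤ heatK d t v := by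
  unfold heatK; positivity

lemma continuous_heatK (t : ℝ) : Continuous (heatK d t) := by
  unfold heatK; fun_prop

lemma contDiff_heatK (t : ℝ) {n : WithTop ℕ∞} : ContDiff ℝ n (heatK d t) := by
  have h : ContDiff ℝ n (fun x : EuclideanSpace ℝ (Fin d) => ‖x‖ ^ 2) := contDiff_norm_sq ℝ
  unfold heatK
  exact contDiff_const.mul ((h.neg.div_const _).exp)

lemma heatK_eq (t : ℝ) : heatK d t =
    fun v => (4 * π * t) ^ (-(d : ℝ) / 2) * rexp (-(1 / (4 * t)) * ‖v‖ ^ 2) := by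
  ext v; unfold heatK; congr 2; ring

lemma heatK_le {t : ℝ} (ht : 0 < t) (v : EuclideanSpace ℝ (Fin d)) :
    heatK d t v ≤ (4 * π * t) ^ (-(d : ℝ) / 2) := by
  rw [heatK_eq]
  have : rexp (-(1 / (4 * t)) * ‖v‖ ^ 2) ≤ 1 := by
    rw [Real.exp_le_one_iff, neg_mul]
    exact neg_nonpos.2 (by positivity)
  exact mul_le_of_le_one_right (by positivity) this

lemma heatK_neg (t : ℝ) (v : EuclideanSpace ℝ (Fin d)) : heatK d t (-v) = heatK d t v := by
  simp [heatK]

lemma integrable_heatK {t : ℝ} (ht : 0 < t) : Integrable (heatK d t) := by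
  rw [heatK_eq]
  exact (integrable_exp_neg_mul_norm_sq (by positivity)).const_mul _

lemma integral_heatK {t : ℝ} (ht : 0 < t) : ∫ v, heatK d t v = 1 := by
  simp only [heatK_eq]
  rw [integral_const_mul, GaussianFourier.integral_rexp_neg_mul_sq_norm (by positivity)]
  have : π / (1 / (4 * t)) = 4 * π * t := by field_simp
  rw [this, ← Real.rpow_add (by positivity), finrank_euclideanSpace_fin, neg_div,
    neg_add_cancel, Real.rpow_zero]

lemma contDiff_pd {n m : WithTop ℕ∞} {f : EuclideanSpace ℝ (Fin d) → ℝ} (hf : ContDiff ℝ n f)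
    (h : m + 1 ≤ n) (i : Fin d) : ContDiff ℝ m (pd i f) :=
  (hf.fderiv_right h).clm_apply contDiff_const

lemma hasCompactSupport_pd {f : EuclideanSpace ℝ (Fin d) → ℝ} (hf : HasCompactSupport f)
    (i : Fin d) : HasCompactSupport (pd i f) :=
  hf.fderiv_apply ℝ _

lemma contDiff_lap {n m : WithTop ℕ∞} {f : EuclideanSpace ℝ (Fin d) → ℝ} (hf : ContDiff ℝ n f)
    (h : m + 1 + 1 ≤ n) : ContDiff ℝ m (lap f) :=
  ContDiff.sum fun i _ => contDiff_pd (contDiff_pd hf h i) le_rfl i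

lemma hasCompactSupport_lap {f : EuclideanSpace ℝ (Fin d) → ℝ} (hf : HasCompactSupport f) :
    HasCompactSupport (lap f) := by
  refine hf.of_isClosed_subset (isClosed_tsupport _) (closure_minimal (fun x hx => ?_)
    (isClosed_tsupport _))
  obtain ⟨i, -, hi⟩ := Finset.exists_ne_zero_of_sum_ne_zero (Function.mem_support.1 hx)
  exact (tsupport_fderiv_apply_subset ℝ _).trans (tsupport_fderiv_apply_subset ℝ _)
    (subset_tsupport _ hi)

lemma integral_mul_pd {u v : EuclideanSpace ℝ (Fin d) → ℝ} (hu : ContDiff ℝ 1 u)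
    (hv : ContDiff ℝ 1 v) (hc : HasCompactSupport v) (i : Fin d) :
    ∫ x, u x * pd i v x = -∫ x, pd i u x * v x := by
  have hu' : Continuous (pd i u) := (contDiff_pd (m := 0) hu (by norm_num) i).continuous
  have hv' : Continuous (pd i v) := (contDiff_pd (m := 0) hv (by norm_num) i).continuous
  apply integral_mul_fderiv_eq_neg_fderiv_mul_of_integrable
  · exact (hu'.mul hv.continuous).integrable_of_hasCompactSupport hc.mul_left
  · exact (hu.continuous.mul hv').integrable_of_hasCompactSupport
      (hasCompactSupport_pd hc i).mul_left
  · exact (hu.continuous.mul hv.continuous).integrable_of_hasCompactSupport hc.mul_left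
  · exact fun x _ => hu.differentiable one_ne_zero x
  · exact fun x _ => hv.differentiable one_ne_zero x

lemma integral_mul_lap {u v : EuclideanSpace ℝ (Fin d) → ℝ} (hu : ContDiff ℝ 1 u)
    (hv : ContDiff ℝ 2 v) (hc : HasCompactSupport v) :
    ∫ x, u x * lap v x = -∑ i, ∫ x, pd i u x * pd i v x := by
  have h2 (i : Fin d) : ContDiff ℝ 1 (pd i v) := contDiff_pd hv (by norm_num) i
  have h0 (i : Fin d) : Continuous (pd i (pd i v)) :=
    (contDiff_pd (m := 0) (h2 i) (by norm_num) i).continuous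
  have : ∀ x, u x * lap v x = ∑ i, u x * pd i (pd i v) x := fun x => Finset.mul_sum _ _ _
  simp_rw [this]
  rw [integral_finsetSum, ← Finset.sum_neg_distrib]
  · exact Finset.sum_congr rfl fun i _ =>
      integral_mul_pd hu (h2 i) (hasCompactSupport_pd hc i) i
  · exact fun i _ => (hu.continuous.mul (h0 i)).integrable_of_hasCompactSupport
      (hasCompactSupport_pd (hasCompactSupport_pd hc i) i).mul_left

lemma integral_mul_lap_comm {u v : EuclideanSpace ℝ (Fin d) → ℝ} (hu : ContDiff ℝ 2 u)
    (hv : ContDiff ℝ 2 v) (hc : HasCompactSupport v) :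
    ∫ x, u x * lap v x = ∫ x, lap u x * v x := by
  have h2 (i : Fin d) : ContDiff ℝ 1 (pd i u) := contDiff_pd hu (by norm_num) i
  have h0 (i : Fin d) : Continuous (pd i (pd i u)) :=
    (contDiff_pd (m := 0) (h2 i) (by norm_num) i).continuous
  have : ∀ x, lap u x * v x = ∑ i, pd i (pd i u) x * v x := fun x => Finset.sum_mul _ _ _
  rw [integral_mul_lap (hu.of_le (by norm_num)) hv hc]
  simp_rw [this]
  rw [integral_finsetSum, ← Finset.sum_neg_distrib]
  · refine Finset.sum_congr rfl fun i _ => ?_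
    rw [integral_mul_pd (h2 i) (hv.of_le (by norm_num)) hc i, neg_neg]
  · exact fun i _ => ((h0 i).mul hv.continuous).integrable_of_hasCompactSupport hc.mul_left

lemma pd_heatK (t : ℝ) (i : Fin d) (v : EuclideanSpace ℝ (Fin d)) :
    pd i (heatK d t) v = -(v i / (2 * t)) * heatK d t v := by
  have h := (((hasStrictFDerivAt_norm_sq v).hasFDerivAt.const_mul (-(1 / (4 * t)))).exp).const_mul
    ((4 * π * t) ^ (-(d : ℝ) / 2))
  rw [pd, heatK_eq, h.fderiv]
  simp [EuclideanSpace.inner_single_right]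
  ring

lemma lap_heatK {t : ℝ} (ht : 0 < t) (v : EuclideanSpace ℝ (Fin d)) :
    lap (heatK d t) v = (‖v‖ ^ 2 / (4 * t ^ 2) - d / (2 * t)) * heatK d t v := by
  have h1 (i : Fin d) : pd i (pd i (heatK d t)) v
      = (v i ^ 2 / (4 * t ^ 2) - 1 / (2 * t)) * heatK d t v := by
    have hh : pd i (heatK d t) = fun v => -(v i / (2 * t)) * heatK d t v := by
      ext w; exact pd_heatK t i w
    have hc : HasFDerivAt (fun v : EuclideanSpace ℝ (Fin d) => -(1 / (2 * t)) * v i)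
        (-(1 / (2 * t)) • EuclideanSpace.proj (𝕜 := ℝ) i) v :=
      (EuclideanSpace.proj (𝕜 := ℝ) i : EuclideanSpace ℝ (Fin d) →L[ℝ] ℝ).hasFDerivAt.const_mul _
    have hq : HasFDerivAt (heatK d t) (fderiv ℝ (heatK d t) v) v :=
      ((contDiff_heatK t (n := 1)).differentiable one_ne_zero v).hasFDerivAt
    have hm := hc.mul hq
    have hp := pd_heatK t i v
    rw [pd] at hp
    have he : (fun v : EuclideanSpace ℝ (Fin d) => -(v i / (2 * t)) * heatK d t v)
        = (fun v => -(1 / (2 * t)) * v i) * heatK d t := by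
      ext w; simp only [Pi.mul_apply]; ring
    rw [hh, pd, he, hm.fderiv]
    simp [hp]
    field_simp
    ring
  rw [lap, Finset.sum_congr rfl fun i _ => h1 i, ← Finset.sum_mul, Finset.sum_sub_distrib,
    EuclideanSpace.norm_sq_eq, Finset.sum_div]
  simp
  left
  field_simp

lemma hasDerivAt_heatK {t : ℝ} (ht : 0 < t) (v : EuclideanSpace ℝ (Fin d)) :
    HasDerivAt (fun t => heatK d t v) (lap (heatK d t) v) t := by
  rw [lap_heatK ht]
  have h1 : HasDerivAt (fun t : ℝ => (4 * π * t) ^ (-(d : ℝ) / 2))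
      (4 * π * (-(d : ℝ) / 2) * (4 * π * t) ^ (-(d : ℝ) / 2 - 1)) t := by
    have := (hasDerivAt_const_mul (4 * π) (x := t)).rpow_const (p := -(d : ℝ) / 2)
      (Or.inl (by positivity))
    simpa using this
  have h2 : HasDerivAt (fun t : ℝ => rexp (-‖v‖ ^ 2 / (4 * t)))
      (rexp (-‖v‖ ^ 2 / (4 * t)) * (‖v‖ ^ 2 / (4 * t ^ 2))) t := by
    have h3 := ((hasDerivAt_const_mul (4 : ℝ) (x := t)).inv (by positivity)).const_mul (-‖v‖ ^ 2)
    have h4 := h3.exp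
    refine h4.congr_deriv ?_
    change rexp (-‖v‖ ^ 2 / (4 * t)) * (-‖v‖ ^ 2 * (-4 / (4 * t) ^ 2)) = _
    field_simp
  refine (h1.mul h2).congr_deriv ?_
  rw [Real.rpow_sub_one (by positivity)]
  unfold heatK
  field_simp
  ring

lemma heatK_scale {t : ℝ} (ht : 0 < t) (v : EuclideanSpace ℝ (Fin d)) :
    ((√t)⁻¹) ^ d * heatK d 1 ((√t)⁻¹ • v) = heatK d t v := by
  have hs : (√t) ^ 2 = t := Real.sq_sqrt ht.le
  have h1 : ((√t)⁻¹) ^ d = t ^ (-(d : ℝ) / 2) := by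
    rw [Real.sqrt_eq_rpow, ← Real.rpow_neg ht.le, ← Real.rpow_natCast, ← Real.rpow_mul ht.le]
    congr 1; ring
  have h2 : ‖(√t)⁻¹ • v‖ ^ 2 = ‖v‖ ^ 2 / t := by
    rw [norm_smul, mul_pow, norm_inv, inv_pow, Real.norm_of_nonneg (Real.sqrt_nonneg t), hs]
    ring
  unfold heatK
  rw [h1, h2, mul_one, Real.mul_rpow (by positivity : (0 : ℝ) ≤ 4 * π) ht.le]
  have : -(‖v‖ ^ 2 / t) / (4 * 1) = -‖v‖ ^ 2 / (4 * t) := by field_simp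
  rw [this]; ring

lemma tendsto_norm_pow_mul_heatK_one :
    Tendsto (fun v : EuclideanSpace ℝ (Fin d) => ‖v‖ ^ d * heatK d 1 v)
      (Bornology.cobounded _) (𝓝 0) := by
  have A : Tendsto (fun w : EuclideanSpace ℝ (Fin d) => ‖w‖ ^ 2)
      (Bornology.cobounded _) atTop :=
    (tendsto_pow_atTop two_ne_zero).comp tendsto_norm_cobounded_atTop
  have B := ((tendsto_rpow_mul_exp_neg_mul_atTop_nhds_zero (d / 2 : ℝ) (1 / 4)
    (by norm_num)).comp A).const_mul ((4 * π * 1) ^ (-(d : ℝ) / 2))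
  rw [mul_zero] at B
  refine B.congr fun v => ?_
  have h : (‖v‖ ^ 2) ^ (d / 2 : ℝ) = ‖v‖ ^ d := by
    rw [← Real.rpow_natCast, ← Real.rpow_mul (norm_nonneg _), ← Real.rpow_natCast]
    congr 1; push_cast; ring
  simp only [Function.comp_apply, h, heatK]
  have : -‖v‖ ^ 2 / (4 * 1) = -(1 / 4) * ‖v‖ ^ 2 := by ring
  rw [this]; ring

lemma tendsto_integral_heatK_mul_zero {φ : EuclideanSpace ℝ (Fin d) → ℝ} (hφ : Continuous φ)
    (hc : HasCompactSupport φ) :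
    Tendsto (fun t => ∫ v, heatK d t v * φ v) (𝓝[>] 0) (𝓝 (φ 0)) := by
  have h := tendsto_integral_comp_smul_smul_of_integrable (μ := volume) (φ := heatK d 1)
    (heatK_nonneg one_pos) (integral_heatK one_pos)
    (by simpa using tendsto_norm_pow_mul_heatK_one)
    (hφ.integrable_of_hasCompactSupport hc) hφ.continuousAt
  have hs : Tendsto (fun t : ℝ => (√t)⁻¹) (𝓝[>] 0) atTop := by
    refine tendsto_inv_nhdsGT_zero.comp (tendsto_nhdsWithin_iff.2 ⟨?_, ?_⟩)
    · simpa using (Real.continuous_sqrt.tendsto 0).mono_left nhdsWithin_le_nhds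
    · filter_upwards [self_mem_nhdsWithin] with t ht using Real.sqrt_pos.2 ht
  refine (h.comp hs).congr' ?_
  filter_upwards [self_mem_nhdsWithin] with t ht
  simp only [Function.comp_apply, finrank_euclideanSpace_fin, heatK_scale ht, smul_eq_mul]

lemma abs_lap_heatK_le {s t : ℝ} (hs : 0 < s) (hst : s ≤ t) (v : EuclideanSpace ℝ (Fin d)) :
    |lap (heatK d t) v| ≤
      (‖v‖ ^ 2 / (4 * s ^ 2) + d / (2 * s)) * (4 * π * s) ^ (-(d : ℝ) / 2) := by
  have ht : 0 < t := hs.trans_le hst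
  rw [lap_heatK ht, abs_mul, abs_of_nonneg (heatK_nonneg ht v)]
  have h1 : |‖v‖ ^ 2 / (4 * t ^ 2) - d / (2 * t)| ≤ ‖v‖ ^ 2 / (4 * s ^ 2) + d / (2 * s) := by
    refine (abs_sub _ _).trans ?_
    rw [abs_of_nonneg (by positivity), abs_of_nonneg (by positivity)]
    gcongr
  have h2 : heatK d t v ≤ (4 * π * s) ^ (-(d : ℝ) / 2) := by
    refine (heatK_le ht v).trans (Real.rpow_le_rpow_of_nonpos (by positivity) (by gcongr) ?_)
    rw [neg_div]
    exact neg_nonpos.2 (by positivity)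
  exact mul_le_mul h1 h2 (heatK_nonneg ht v) (by positivity)

lemma abs_lap_heatK_le_of_one_le {t : ℝ} (ht : 1 ≤ t) (v : EuclideanSpace ℝ (Fin d)) :
    |lap (heatK d t) v| ≤
      t ^ (-(d : ℝ) / 2 - 1) * ((‖v‖ ^ 2 / 4 + d / 2) * (4 * π) ^ (-(d : ℝ) / 2)) := by
  have ht0 : 0 < t := one_pos.trans_le ht
  refine (abs_lap_heatK_le ht0 le_rfl v).trans ?_
  rw [Real.mul_rpow (by positivity) ht0.le, Real.rpow_sub_one ht0.ne']
  have h : ‖v‖ ^ 2 / (4 * t ^ 2) + d / (2 * t) ≤ (‖v‖ ^ 2 / 4 + d / 2) / t := by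
    have : (‖v‖ ^ 2 / 4 + d / 2) / t = ‖v‖ ^ 2 / (4 * t) + d / (2 * t) := by field_simp
    rw [this]
    gcongr
    nlinarith
  calc _ ≤ (‖v‖ ^ 2 / 4 + d / 2) / t * ((4 * π) ^ (-(d : ℝ) / 2) * t ^ (-(d : ℝ) / 2)) := by
        gcongr
    _ = _ := by ring

lemma hasDerivAt_integral_heatK_mul {φ : EuclideanSpace ℝ (Fin d) → ℝ} (hφ : Continuous φ)
    (hc : HasCompactSupport φ) {t : ℝ} (ht : 0 < t) :
    HasDerivAt (fun t => ∫ v, heatK d t v * φ v) (∫ v, lap (heatK d t) v * φ v) t := by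
  have hl (t : ℝ) : Continuous (lap (heatK d t)) :=
    (contDiff_lap (m := 0) (contDiff_heatK t (n := 2)) (by norm_num)).continuous
  refine (hasDerivAt_integral_of_dominated_loc_of_deriv_le (s := Set.Ioi (t / 2))
    (bound := fun v => (‖v‖ ^ 2 / (4 * (t / 2) ^ 2) + d / (2 * (t / 2))) *
      (4 * π * (t / 2)) ^ (-(d : ℝ) / 2) * |φ v|)
    (F := fun t v => heatK d t v * φ v) (F' := fun t v => lap (heatK d t) v * φ v)
    (Ioi_mem_nhds (by linarith)) ?_ ?_ ?_ ?_ ?_ ?_).2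
  · exact Eventually.of_forall fun s =>
      ((continuous_heatK s).mul hφ).aestronglyMeasurable
  · exact ((continuous_heatK t).mul hφ).integrable_of_hasCompactSupport hc.mul_left
  · exact ((hl t).mul hφ).aestronglyMeasurable
  · refine ae_of_all _ fun v s hs => ?_
    rw [norm_mul, Real.norm_eq_abs, Real.norm_eq_abs]
    exact mul_le_mul_of_nonneg_right (abs_lap_heatK_le (half_pos ht) hs.out.le v) (abs_nonneg _)
  · refine Continuous.integrable_of_hasCompactSupport (by fun_prop) ?_
    exact HasCompactSupport.mul_left hc.norm
  · exact ae_of_all _ fun v s hs =>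
      (hasDerivAt_heatK ((half_pos ht).trans hs) v).mul_const (φ v)

lemma abs_integral_heatK_mul_le {φ : EuclideanSpace ℝ (Fin d) → ℝ} {M : ℝ}
    (hM : ∀ v, |φ v| ≤ M) {t : ℝ} (ht : 0 < t) : |∫ v, heatK d t v * φ v| ≤ M := by
  rw [← Real.norm_eq_abs]
  calc ‖∫ v, heatK d t v * φ v‖ ≤ ∫ v, heatK d t v * M := by
        refine norm_integral_le_of_norm_le ((integrable_heatK ht).mul_const M)
          (ae_of_all _ fun v => ?_)
        rw [norm_mul, Real.norm_of_nonneg (heatK_nonneg ht v)]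
        exact mul_le_mul_of_nonneg_left (hM v) (heatK_nonneg ht v)
    _ = M := by rw [integral_mul_const, integral_heatK ht, one_mul]

lemma tendsto_integral_heatK_mul_atTop (hd : 1 ≤ d) {φ : EuclideanSpace ℝ (Fin d) → ℝ}
    (hφ : Integrable φ) : Tendsto (fun t => ∫ v, heatK d t v * φ v) atTop (𝓝 0) := by
  have hd' : (0 : ℝ) < d / 2 := by
    have : (0 : ℝ) < d := by exact_mod_cast hd
    positivity
  have h1 : Tendsto (fun t : ℝ => (4 * π * t) ^ (-(d : ℝ) / 2) * ∫ v, |φ v|) atTop (𝓝 0) := by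
    rw [← zero_mul (∫ v, |φ v|)]
    refine Tendsto.mul_const _ ?_
    rw [neg_div]
    exact (tendsto_rpow_neg_atTop hd').comp (tendsto_id.const_mul_atTop (by positivity))
  refine squeeze_zero_norm' ?_ h1
  filter_upwards [Ioi_mem_atTop 0] with t ht
  rw [← integral_const_mul]
  refine norm_integral_le_of_norm_le (hφ.abs.const_mul _) (ae_of_all _ fun v => ?_)
  rw [norm_mul, Real.norm_of_nonneg (heatK_nonneg ht v)]
  exact mul_le_mul_of_nonneg_right (heatK_le ht v) (norm_nonneg _)

lemma integrableOn_integral_heatK_mul_lap (hd : 1 ≤ d) {φ : EuclideanSpace ℝ (Fin d) → ℝ}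
    (hφ : ContDiff ℝ 2 φ) (hc : HasCompactSupport φ) :
    IntegrableOn (fun t => ∫ v, heatK d t v * lap φ v) (Set.Ioi 0) := by
  have heq : ∀ t, ∫ v, heatK d t v * lap φ v = ∫ v, lap (heatK d t) v * φ v := fun t =>
    integral_mul_lap_comm (contDiff_heatK t) hφ hc
  have hmeas : AEStronglyMeasurable (fun t => ∫ v, heatK d t v * lap φ v)
      (volume.restrict (Set.Ioi 0)) := by
    refine (aestronglyMeasurable_deriv (fun t => ∫ v, heatK d t v * φ v) _).congr ?_
    filter_upwards [ae_restrict_mem measurableSet_Ioi] with t ht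
    rw [heq, (hasDerivAt_integral_heatK_mul hφ.continuous hc ht).deriv]
  have hlap : Continuous (lap φ) := (contDiff_lap (m := 0) hφ (by norm_num)).continuous
  obtain ⟨M, hM⟩ := (hasCompactSupport_lap hc).exists_bound_of_continuous hlap
  rw [← Set.Ioc_union_Ioi_eq_Ioi zero_le_one]
  refine IntegrableOn.union ?_ ?_
  · refine Integrable.mono' (g := fun _ => M) (integrableOn_const (by simp))
      (hmeas.mono_measure (Measure.restrict_mono Set.Ioc_subset_Ioi_self le_rfl)) ?_
    filter_upwards [ae_restrict_mem measurableSet_Ioc] with t ht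
    exact abs_integral_heatK_mul_le hM ht.1
  · have hd' : (0 : ℝ) < d := by exact_mod_cast hd
    refine ((integrableOn_Ioi_rpow_of_lt (a := -(d : ℝ) / 2 - 1) (by linarith)
      one_pos).mul_const (∫ v : EuclideanSpace ℝ (Fin d),
        (‖v‖ ^ 2 / 4 + d / 2) * (4 * π) ^ (-(d : ℝ) / 2) * |φ v|)).mono'
      (hmeas.mono_measure (Measure.restrict_mono (Set.Ioi_subset_Ioi zero_le_one) le_rfl)) ?_
    filter_upwards [ae_restrict_mem measurableSet_Ioi] with t ht
    rw [heq, ← integral_const_mul]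
    refine norm_integral_le_of_norm_le (Integrable.const_mul ?_ _) (ae_of_all _ fun v => ?_)
    · refine Continuous.integrable_of_hasCompactSupport
        (by have := hφ.continuous; fun_prop) ?_
      exact HasCompactSupport.mul_left hc.norm
    · rw [norm_mul, ← mul_assoc]
      exact mul_le_mul_of_nonneg_right (abs_lap_heatK_le_of_one_le ht.out.le v) (norm_nonneg _)

lemma integral_integral_heatK_mul_lap (hd : 1 ≤ d) {φ : EuclideanSpace ℝ (Fin d) → ℝ}
    (hφ : ContDiff ℝ 2 φ) (hc : HasCompactSupport φ) :
    ∫ t in Set.Ioi (0 : ℝ), ∫ v, heatK d t v * lap φ v = -φ 0 := by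
  have hF := tendsto_integral_heatK_mul_zero hφ.continuous hc
  set F := fun t => ∫ v, heatK d t v * φ v with hFdef
  have hev {t : ℝ} (ht : 0 < t) : Function.update F 0 (φ 0) =ᶠ[𝓝 t] F := by
    filter_upwards [Ioi_mem_nhds ht] with s hs
    exact Function.update_of_ne hs.ne' _ _
  have h := integral_Ioi_of_hasDerivAt_of_tendsto (f := Function.update F 0 (φ 0)) (a := 0)
    (m := 0) (f' := fun t => ∫ v, heatK d t v * lap φ v) ?_ (fun t ht => ?_)
    (integrableOn_integral_heatK_mul_lap hd hφ hc) ?_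
  · rw [h]; simp
  · rw [continuousWithinAt_update_same, Set.Ici_sdiff_left]
    exact hF
  · rw [integral_mul_lap_comm (contDiff_heatK t) hφ hc]
    exact (hasDerivAt_integral_heatK_mul hφ.continuous hc ht).congr_of_eventuallyEq (hev ht)
  · refine (tendsto_integral_heatK_mul_atTop hd
      (hφ.continuous.integrable_of_hasCompactSupport hc)).congr' ?_
    filter_upwards [Ioi_mem_atTop 0] with t ht
    exact (Function.update_of_ne (ne_of_gt (Set.mem_Ioi.1 ht)) (φ 0) F).symm

lemma heatK_mul_heatK {t : ℝ} (ht : 0 < t) (x y w : EuclideanSpace ℝ (Fin d)) :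
    heatK d t (x - y) * heatK d t (x - w)
      = heatK d (2 * t) (y - w) * heatK d (t / 2) (x - (1 / 2 : ℝ) • (y + w)) := by
  have hp : ‖x - y‖ ^ 2 + ‖x - w‖ ^ 2
      = 2 * ‖x - (1 / 2 : ℝ) • (y + w)‖ ^ 2 + ‖y - w‖ ^ 2 / 2 := by
    have h := parallelogram_law_with_norm ℝ (x - y) (x - w)
    have h1 : x - y + (x - w) = (2 : ℝ) • (x - (1 / 2 : ℝ) • (y + w)) := by module
    have h2 : x - y - (x - w) = -(y - w) := by abel
    rw [h1, h2, norm_neg, norm_smul, Real.norm_of_nonneg zero_le_two] at h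
    linarith
  have he : -‖x - y‖ ^ 2 / (4 * t) + -‖x - w‖ ^ 2 / (4 * t)
      = -‖y - w‖ ^ 2 / (4 * (2 * t)) + -‖x - (1 / 2 : ℝ) • (y + w)‖ ^ 2 / (4 * (t / 2)) := by
    field_simp
    linarith
  have hr : (4 * π * t) ^ (-(d : ℝ) / 2) * (4 * π * t) ^ (-(d : ℝ) / 2)
      = (4 * π * (2 * t)) ^ (-(d : ℝ) / 2) * (4 * π * (t / 2)) ^ (-(d : ℝ) / 2) := by
    rw [← Real.mul_rpow (by positivity) (by positivity),
      ← Real.mul_rpow (by positivity) (by positivity)]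
    congr 1; ring
  unfold heatK
  rw [mul_mul_mul_comm, hr, ← Real.exp_add, he, Real.exp_add, mul_mul_mul_comm]

lemma integrable_norm_mul_heatK {t : ℝ} (ht : 0 < t) :
    Integrable (fun v : EuclideanSpace ℝ (Fin d) => ‖v‖ * heatK d t v) := by
  rw [heatK_eq]
  refine ((integrable_norm_mul_exp_neg_mul_norm_sq (d := d) (b := 1 / (4 * t))
    (by positivity)).const_mul ((4 * π * t) ^ (-(d : ℝ) / 2))).congr (ae_of_all _ fun v => ?_)
  ring

lemma integral_inner_mul_heatK_sub {t : ℝ} (ht : 0 < t) (c m : EuclideanSpace ℝ (Fin d)) :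
    ∫ x, ⟪c, x⟫_ℝ * heatK d t (x - m) = ⟪c, m⟫_ℝ := by
  have hodd : ∫ x, ⟪c, x⟫_ℝ * heatK d t x = 0 := by
    have h := integral_neg_eq_self (fun x => ⟪c, x⟫_ℝ * heatK d t x) volume
    simp only [inner_neg_right, heatK_neg, neg_mul, integral_neg] at h
    linarith
  have hint : Integrable (fun x : EuclideanSpace ℝ (Fin d) => ⟪c, x⟫_ℝ * heatK d t x) := by
    refine ((integrable_norm_mul_heatK (d := d) ht).const_mul ‖c‖).mono'
      (by have := continuous_heatK (d := d) t; fun_prop) (ae_of_all _ fun v => ?_)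
    rw [norm_mul, Real.norm_of_nonneg (heatK_nonneg ht v), ← mul_assoc]
    exact mul_le_mul_of_nonneg_right (norm_inner_le_norm c v) (heatK_nonneg ht v)
  rw [← integral_add_right_eq_self _ m]
  simp only [add_sub_cancel_right, inner_add_right, add_mul]
  rw [integral_add hint ((integrable_heatK ht).const_mul _), hodd, integral_const_mul,
    integral_heatK ht, zero_add, mul_one]

lemma integral_inner_mul_heatK_mul_heatK {t : ℝ} (ht : 0 < t)
    (c y w : EuclideanSpace ℝ (Fin d)) :
    ∫ x, ⟪c, x⟫_ℝ * (heatK d t (x - y) * heatK d t (x - w))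
      = (⟪c, y⟫_ℝ + ⟪c, w⟫_ℝ) / 2 * heatK d (2 * t) (y - w) := by
  have h (x : EuclideanSpace ℝ (Fin d)) :
      ⟪c, x⟫_ℝ * (heatK d t (x - y) * heatK d t (x - w)) = heatK d (2 * t) (y - w) *
        (⟪c, x⟫_ℝ * heatK d (t / 2) (x - (1 / 2 : ℝ) • (y + w))) := by
    rw [heatK_mul_heatK ht]; ring
  simp_rw [h]
  rw [integral_const_mul, integral_inner_mul_heatK_sub (half_pos ht), inner_smul_right,
    inner_add_right]
  ring

lemma heatK_sub_le {t R : ℝ} (ht : 0 < t) (x : EuclideanSpace ℝ (Fin d))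
    {y : EuclideanSpace ℝ (Fin d)} (hy : ‖y‖ ≤ R) :
    heatK d t (x - y) ≤ (4 * π * t) ^ (-(d : ℝ) / 2) *
      (rexp (R ^ 2 / (4 * t)) * rexp (-(1 / (8 * t)) * ‖x‖ ^ 2)) := by
  unfold heatK
  rw [← Real.exp_add]
  gcongr
  have h1 : ‖x‖ ≤ ‖x - y‖ + ‖y‖ := by simpa using norm_add_le (x - y) y
  have h2 : ‖x‖ ^ 2 ≤ 2 * ‖x - y‖ ^ 2 + 2 * R ^ 2 := by
    nlinarith [norm_nonneg x, norm_nonneg y, norm_nonneg (x - y), sq_nonneg (‖x - y‖ - R)]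
  have h3 : R ^ 2 / (4 * t) + -(1 / (8 * t)) * ‖x‖ ^ 2 - -‖x - y‖ ^ 2 / (4 * t)
      = (2 * ‖x - y‖ ^ 2 + 2 * R ^ 2 - ‖x‖ ^ 2) / (8 * t) := by
    field_simp; ring
  have h4 : 0 ≤ (2 * ‖x - y‖ ^ 2 + 2 * R ^ 2 - ‖x‖ ^ 2) / (8 * t) :=
    div_nonneg (by linarith) (by positivity)
  linarith

section

variable {f : EuclideanSpace ℝ (Fin d) → ℝ}

lemma integrable_inner_mul_heatK_mul_heatK {t : ℝ} (ht : 0 < t) (c : EuclideanSpace ℝ (Fin d))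
    (hf : Continuous f) (hc : HasCompactSupport f) :
    Integrable (Function.uncurry fun (x : EuclideanSpace ℝ (Fin d))
      (p : EuclideanSpace ℝ (Fin d) × EuclideanSpace ℝ (Fin d)) =>
      ⟪c, x⟫_ℝ * (heatK d t (x - p.1) * f p.1 * (heatK d t (x - p.2) * f p.2)))
      (volume.prod volume) := by
  obtain ⟨R, hR⟩ := hc.isCompact.isBounded.exists_norm_le
  have hfi : Integrable (fun y => |f y|) := (hf.integrable_of_hasCompactSupport hc).abs
  set A := (4 * π * t) ^ (-(d : ℝ) / 2)
  have hA0 : 0 ≤ A := by positivity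
  have hg := (integrable_norm_mul_exp_neg_mul_norm_sq (d := d) (b := 1 / (8 * t))
    (by positivity)).const_mul (‖c‖ * A ^ 2 * rexp (R ^ 2 / (4 * t)))
  have hq := continuous_heatK (d := d) t
  refine (hg.mul_prod (hfi.mul_prod hfi)).mono'
    (Continuous.aestronglyMeasurable (by unfold Function.uncurry; fun_prop))
    (ae_of_all _ fun ⟨x, y, w⟩ => ?_)
  simp only [Function.uncurry, norm_mul, Real.norm_eq_abs, abs_of_nonneg (heatK_nonneg ht _)]
  have h1 : |⟪c, x⟫_ℝ| ≤ ‖c‖ * ‖x‖ := abs_real_inner_le_norm c x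
  have h2 : heatK d t (x - w) * |f w| ≤ A * |f w| :=
    mul_le_mul_of_nonneg_right (heatK_le ht _) (abs_nonneg _)
  have h3 : heatK d t (x - y) * |f y| ≤
      A * (rexp (R ^ 2 / (4 * t)) * rexp (-(1 / (8 * t)) * ‖x‖ ^ 2)) * |f y| := by
    by_cases hy : f y = 0
    · simp [hy]
    · exact mul_le_mul_of_nonneg_right
        (heatK_sub_le ht x (hR y (subset_tsupport _ hy))) (abs_nonneg _)
  have hn := heatK_nonneg (d := d) ht
  calc |⟪c, x⟫_ℝ| * (heatK d t (x - y) * |f y| * (heatK d t (x - w) * |f w|))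
      ≤ ‖c‖ * ‖x‖ * (A * (rexp (R ^ 2 / (4 * t)) * rexp (-(1 / (8 * t)) * ‖x‖ ^ 2)) * |f y| *
        (A * |f w|)) := by
        have := hn (x - y)
        have := hn (x - w)
        gcongr
    _ = _ := by ring

lemma integral_prod_symmetrize {Q : EuclideanSpace ℝ (Fin d) → ℝ} {a : ℝ} (hQ : Continuous Q)
    (hQa : ∀ v, |Q v| ≤ a) (hQn : ∀ v, Q (-v) = Q v) (c : EuclideanSpace ℝ (Fin d))
    (hf : Continuous f) (hc : HasCompactSupport f) :
    ∫ p : EuclideanSpace ℝ (Fin d) × EuclideanSpace ℝ (Fin d),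
      f p.1 * f p.2 * ((⟪c, p.1⟫_ℝ + ⟪c, p.2⟫_ℝ) / 2 * Q (p.1 - p.2))
      = ∫ y, ∫ w, ⟪c, y⟫_ℝ * f y * (f w * Q (y - w)) := by
  set A : EuclideanSpace ℝ (Fin d) × EuclideanSpace ℝ (Fin d) → ℝ :=
    fun p => ⟪c, p.1⟫_ℝ * f p.1 * (f p.2 * Q (p.1 - p.2)) with hAdef
  have hfi : Integrable f := hf.integrable_of_hasCompactSupport hc
  have hgi : Integrable (fun y => ⟪c, y⟫_ℝ * f y) :=
    Continuous.integrable_of_hasCompactSupport (by fun_prop) hc.mul_left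
  have hA : Integrable A := by
    refine ((hgi.mul_prod hfi).norm.mul_const a).mono'
      (Continuous.aestronglyMeasurable (by fun_prop)) (ae_of_all _ fun p => ?_)
    simp only [hAdef]
    rw [← mul_assoc, norm_mul]
    exact mul_le_mul_of_nonneg_left (hQa _) (norm_nonneg _)
  have hsplit : ∀ p : EuclideanSpace ℝ (Fin d) × EuclideanSpace ℝ (Fin d),
      f p.1 * f p.2 * ((⟪c, p.1⟫_ℝ + ⟪c, p.2⟫_ℝ) / 2 * Q (p.1 - p.2))
        = (1 / 2) * A p + (1 / 2) * A p.swap := by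
    intro p
    have : Q (p.2 - p.1) = Q (p.1 - p.2) := by rw [← hQn, neg_sub]
    simp only [hAdef, Prod.fst_swap, Prod.snd_swap, this]
    ring
  have hswap : ∫ p : EuclideanSpace ℝ (Fin d) × EuclideanSpace ℝ (Fin d), A p.swap = ∫ p, A p := integral_prod_swap A
  have hAs : Integrable fun p : EuclideanSpace ℝ (Fin d) × EuclideanSpace ℝ (Fin d) =>
    A p.swap := hA.swap
  simp_rw [hsplit]
  rw [integral_add (hA.const_mul _) (hAs.const_mul _), integral_const_mul,
    integral_const_mul, hswap, ← add_mul, add_halves, one_mul]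
  exact integral_prod A hA

lemma integral_inner_mul_heatConv_sq {t : ℝ} (ht : 0 < t) (c : EuclideanSpace ℝ (Fin d))
    (hf : Continuous f) (hc : HasCompactSupport f) :
    ∫ x, ⟪c, x⟫_ℝ * heatConv t f x ^ 2
      = ∫ v, heatK d (2 * t) v * ∫ y, ⟪c, y⟫_ℝ * f y * f (y - v) := by
  have ht2 : 0 < 2 * t := by positivity
  have hQ := continuous_heatK (d := d) (2 * t)
  have h1 (x : EuclideanSpace ℝ (Fin d)) : ⟪c, x⟫_ℝ * heatConv t f x ^ 2 =
      ∫ p : EuclideanSpace ℝ (Fin d) × EuclideanSpace ℝ (Fin d),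
        ⟪c, x⟫_ℝ * (heatK d t (x - p.1) * f p.1 * (heatK d t (x - p.2) * f p.2)) := by
    rw [integral_const_mul, sq, heatConv]
    congr 1
    exact (integral_prod_mul (fun y => heatK d t (x - y) * f y)
      (fun y => heatK d t (x - y) * f y)).symm
  have h2 (p : EuclideanSpace ℝ (Fin d) × EuclideanSpace ℝ (Fin d)) :
      ∫ x, ⟪c, x⟫_ℝ * (heatK d t (x - p.1) * f p.1 * (heatK d t (x - p.2) * f p.2))
        = f p.1 * f p.2 * ((⟪c, p.1⟫_ℝ + ⟪c, p.2⟫_ℝ) / 2 * heatK d (2 * t) (p.1 - p.2)) := by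
    rw [← integral_inner_mul_heatK_mul_heatK ht, ← integral_const_mul]
    congr 1 with x
    ring
  have h3 (y : EuclideanSpace ℝ (Fin d)) :
      ∫ w, ⟪c, y⟫_ℝ * f y * (f w * heatK d (2 * t) (y - w))
        = ∫ v, ⟪c, y⟫_ℝ * f y * (f (y - v) * heatK d (2 * t) v) := by
    rw [← integral_sub_left_eq_self _ volume y]
    simp only [sub_sub_cancel]
  have hgi : Integrable (fun y => ⟪c, y⟫_ℝ * f y) :=
    Continuous.integrable_of_hasCompactSupport (by fun_prop) hc.mul_left
  obtain ⟨M, hM⟩ := hc.exists_bound_of_continuous hf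
  simp_rw [h1]
  rw [integral_integral_swap (integrable_inner_mul_heatK_mul_heatK ht c hf hc)]
  simp_rw [h2]
  rw [integral_prod_symmetrize hQ
    (fun v => (abs_of_nonneg (heatK_nonneg ht2 v)).trans_le (heatK_le ht2 v))
    (heatK_neg _) c hf hc]
  simp_rw [h3]
  rw [integral_integral_swap]
  · congr 1 with v
    rw [← integral_const_mul]
    congr 1 with y
    ring
  · refine ((hgi.norm.mul_const M).mul_prod (integrable_heatK ht2)).mono'
      (Continuous.aestronglyMeasurable (by unfold Function.uncurry; fun_prop))
      (ae_of_all _ fun ⟨y, v⟩ => ?_)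
    simp only [Function.uncurry]
    rw [norm_mul, norm_mul (f _), Real.norm_of_nonneg (heatK_nonneg ht2 v), ← mul_assoc]
    have := heatK_nonneg ht2 v
    gcongr
    exact hM _

end

section

variable {g h : EuclideanSpace ℝ (Fin d) → ℝ}

open scoped Convolution

lemma pd_convolution (hg : LocallyIntegrable g) (hh : ContDiff ℝ 1 h)
    (hc : HasCompactSupport h) (i : Fin d) :
    pd i (g ⋆[ContinuousLinearMap.mul ℝ ℝ] h) = g ⋆[ContinuousLinearMap.mul ℝ ℝ] pd i h := by
  ext x
  rw [pd, (hc.hasFDerivAt_convolution_right _ hg hh x).fderiv,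
    convolution_precompR_apply _ hg (hc.fderiv ℝ) (hh.continuous_fderiv one_ne_zero)]
  rfl

lemma lap_convolution (hg : LocallyIntegrable g) (hh : ContDiff ℝ 2 h)
    (hc : HasCompactSupport h) :
    lap (g ⋆[ContinuousLinearMap.mul ℝ ℝ] h) = g ⋆[ContinuousLinearMap.mul ℝ ℝ] lap h := by
  have h2 (i : Fin d) : ContDiff ℝ 1 (pd i h) := contDiff_pd hh (by norm_num) i
  have h0 (i : Fin d) : Continuous (pd i (pd i h)) :=
    (contDiff_pd (m := 0) (h2 i) (by norm_num) i).continuous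
  have hci (i : Fin d) := hasCompactSupport_pd hc i
  ext x
  have hs : ∀ i, pd i (pd i (g ⋆[ContinuousLinearMap.mul ℝ ℝ] h)) x
      = ∫ t, g t * pd i (pd i h) (x - t) := fun i => by
    rw [pd_convolution hg (hh.of_le (by norm_num)) hc, pd_convolution hg (h2 i) (hci i)]
    rfl
  rw [lap, Finset.sum_congr rfl fun i _ => hs i, ← integral_finsetSum]
  · simp only [← Finset.mul_sum]
    rfl
  · exact fun i _ => (hasCompactSupport_pd (hci i) i).convolutionExists_right
      (ContinuousLinearMap.mul ℝ ℝ) hg (h0 i) x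

lemma pd_comp_neg (i : Fin d) :
    pd i (fun x => h (-x)) = fun x => -pd i h (-x) := by
  ext x
  have h1 : fderiv ℝ (fun x => h (-x)) x = -fderiv ℝ h (-x) := by
    simpa using fderiv_comp_smul (𝕜 := ℝ) (f := h) (x := x) (-1)
  rw [pd, h1]
  rfl

lemma lap_comp_neg : lap (fun x => h (-x)) = fun x => lap h (-x) := by
  have hn (i : Fin d) (k : EuclideanSpace ℝ (Fin d) → ℝ) :
      pd i (fun x => -k x) = fun x => -pd i k x := by
    ext x
    rw [pd, fderiv_fun_neg]
    rfl
  ext x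
  simp only [lap, pd_comp_neg, hn, neg_neg]

lemma correlation_eq_convolution (v : EuclideanSpace ℝ (Fin d)) :
    ∫ y, g y * h (y - v) = (g ⋆[ContinuousLinearMap.mul ℝ ℝ] fun x => h (-x)) v := by
  simp [convolution]

lemma contDiff_correlation (hg : Continuous g) (hh : ContDiff ℝ 2 h)
    (hc : HasCompactSupport h) : ContDiff ℝ 2 fun v => ∫ y, g y * h (y - v) := by
  simp_rw [correlation_eq_convolution]
  exact (hc.comp_homeomorph (Homeomorph.neg _)).contDiff_convolution_right (n := 2) _
    hg.locallyIntegrable (hh.comp contDiff_neg)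

lemma hasCompactSupport_correlation (hgc : HasCompactSupport g) (hc : HasCompactSupport h) :
    HasCompactSupport fun v => ∫ y, g y * h (y - v) := by
  simp_rw [correlation_eq_convolution]
  exact hgc.convolution _ (hc.comp_homeomorph (Homeomorph.neg _))

lemma lap_correlation (hg : Continuous g) (hh : ContDiff ℝ 2 h) (hc : HasCompactSupport h)
    (v : EuclideanSpace ℝ (Fin d)) :
    lap (fun v => ∫ y, g y * h (y - v)) v = ∫ y, g y * lap h (y - v) := by
  simp_rw [correlation_eq_convolution]
  rw [← lap_comp_neg]
  exact congrFun (lap_convolution hg.locallyIntegrable (hh.comp contDiff_neg)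
    (hc.comp_homeomorph (Homeomorph.neg _))) v

end

lemma norm_gradient_sq (z : EuclideanSpace ℝ (Fin d) → ℝ) (x : EuclideanSpace ℝ (Fin d)) :
    ‖gradient z x‖ ^ 2 = ∑ i, pd i z x ^ 2 := by
  rw [EuclideanSpace.norm_sq_eq]
  refine Finset.sum_congr rfl fun i _ => ?_
  have : gradient z x i = pd i z x := by
    rw [pd, ← InnerProductSpace.toDual_symm_apply (𝕜 := ℝ), EuclideanSpace.inner_single_right]
    simp [gradient]
  rw [this, Real.norm_eq_abs, sq_abs]

lemma integral_inner_mul_lap_mul_self (c : EuclideanSpace ℝ (Fin d))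
    {z : EuclideanSpace ℝ (Fin d) → ℝ} (hz : ContDiff ℝ 2 z) (hc : HasCompactSupport z) :
    ∫ y, ⟪c, y⟫_ℝ * lap z y * z y = -∫ x, ⟪c, x⟫_ℝ * ‖gradient z x‖ ^ 2 := by
  have hz1 : ContDiff ℝ 1 z := hz.of_le (by norm_num)
  have hl : ContDiff ℝ 1 fun y : EuclideanSpace ℝ (Fin d) => ⟪c, y⟫_ℝ :=
    contDiff_const.inner ℝ contDiff_id
  have hp (i : Fin d) : Continuous (pd i z) :=
    (contDiff_pd (m := 0) hz1 (by norm_num) i).continuous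
  have hpc (i : Fin d) := hasCompactSupport_pd hc i
  have hu (i : Fin d) (x : EuclideanSpace ℝ (Fin d)) :
      pd i (fun y => ⟪c, y⟫_ℝ * z y) x = c i * z x + ⟪c, x⟫_ℝ * pd i z x := by
    have h1 : HasFDerivAt (fun y : EuclideanSpace ℝ (Fin d) => ⟪c, y⟫_ℝ) (innerSL ℝ c) x :=
      (innerSL ℝ c).hasFDerivAt
    have h2 := h1.fun_mul (hz1.differentiable one_ne_zero x).hasFDerivAt
    rw [pd, h2.fderiv]
    simp [pd, EuclideanSpace.inner_single_right]
    ring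
  have hzero (i : Fin d) : ∫ x, z x * pd i z x = 0 := by
    have h := integral_mul_pd hz1 hz1 hc i
    simp_rw [mul_comm (pd i z _)] at h
    linarith
  have h1 : ∫ y, ⟪c, y⟫_ℝ * lap z y * z y = ∫ y, (⟪c, y⟫_ℝ * z y) * lap z y := by
    congr 1 with y; ring
  have h2 (i : Fin d) : ∫ x, pd i (fun y => ⟪c, y⟫_ℝ * z y) x * pd i z x
      = ∫ x, ⟪c, x⟫_ℝ * pd i z x ^ 2 := by
    have : ∀ x, pd i (fun y => ⟪c, y⟫_ℝ * z y) x * pd i z x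
        = c i * (z x * pd i z x) + ⟪c, x⟫_ℝ * pd i z x ^ 2 := fun x => by rw [hu]; ring
    simp_rw [this]
    rw [integral_add, integral_const_mul, hzero, mul_zero, zero_add]
    · exact ((hz.continuous.mul (hp i)).integrable_of_hasCompactSupport
        (hpc i).mul_left).const_mul _
    · exact (hl.continuous.mul ((hp i).pow 2)).integrable_of_hasCompactSupport
        (by simp_rw [sq]; exact (hpc i).mul_left.mul_left)
  rw [h1, integral_mul_lap (hl.mul hz1) hz hc]
  simp_rw [h2, norm_gradient_sq, Finset.mul_sum]
  rw [integral_finsetSum]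
  exact fun i _ => (hl.continuous.mul ((hp i).pow 2)).integrable_of_hasCompactSupport
    (by simp_rw [sq]; exact (hpc i).mul_left.mul_left)

end HeatKernel

/-- End of the proof of Lemma A.10:
`∫₀^∞ ∫ ⟨c,x⟩ (e^{ϑsΔ}Δz)(x)² dx ds` converges absolutely and equals
`(1/(2ϑ)) ∫ ⟨c,x⟩ |∇z(x)|² dx`. -/
theorem stmt15 {d : ℕ} (hd : 1 ≤ d) (ϑ : ℝ) (hϑ : 0 < ϑ)
    (c : EuclideanSpace ℝ (Fin d))
    (z : EuclideanSpace ℝ (Fin d) → ℝ) (hz : ContDiff ℝ 4 z)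
    (hsupp : HasCompactSupport z) :
    IntegrableOn
      (fun s => ∫ x, ⟪c, x⟫_ℝ * (heatConv (ϑ * s) (lap z) x) ^ 2)
      (Set.Ioi (0 : ℝ)) ∧
    ∫ s in Set.Ioi (0 : ℝ), ∫ x, ⟪c, x⟫_ℝ * (heatConv (ϑ * s) (lap z) x) ^ 2
      = (1 / (2 * ϑ)) * ∫ x, ⟪c, x⟫_ℝ * ‖gradient z x‖ ^ 2 := by
  have hz2 : ContDiff ℝ 2 z := hz.of_le (by norm_num)
  have hlap : Continuous (lap z) := (contDiff_lap (m := 0) hz2 (by norm_num)).continuous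
  have hlapc : HasCompactSupport (lap z) := hasCompactSupport_lap hsupp
  have hg : Continuous fun y => ⟪c, y⟫_ℝ * lap z y := by fun_prop
  have hgc : HasCompactSupport fun y => ⟪c, y⟫_ℝ * lap z y := hlapc.mul_left
  set φ := fun v => ∫ y, ⟪c, y⟫_ℝ * lap z y * z (y - v) with hφdef
  have hφ : ContDiff ℝ 2 φ := contDiff_correlation hg hz2 hsupp
  have hφc : HasCompactSupport φ := hasCompactSupport_correlation hgc hsupp
  have h2ϑ : 0 < 2 * ϑ := by positivity
  have heq : Set.EqOn (fun s => ∫ x, ⟪c, x⟫_ℝ * (heatConv (ϑ * s) (lap z) x) ^ 2)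
      (fun s => ∫ v, heatK d (2 * ϑ * s) v * lap φ v) (Set.Ioi 0) := by
    intro s hs
    simp only [integral_inner_mul_heatConv_sq (mul_pos hϑ hs) c hlap hlapc, mul_assoc 2 ϑ s,
      hφdef, lap_correlation hg hz2 hsupp]
  constructor
  · rw [integrableOn_congr_fun heq measurableSet_Ioi,
      integrableOn_Ioi_comp_mul_left_iff (fun τ => ∫ v, heatK d τ v * lap φ v) 0 h2ϑ, mul_zero]
    exact integrableOn_integral_heatK_mul_lap hd hφ hφc
  · rw [setIntegral_congr_fun measurableSet_Ioi heq,
      integral_comp_mul_left_Ioi (fun τ => ∫ v, heatK d τ v * lap φ v) 0 h2ϑ, mul_zero,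
      integral_integral_heatK_mul_lap hd hφ hφc]
    simp only [hφdef, sub_zero, integral_inner_mul_lap_mul_self c hz2 hsupp, neg_neg,
      smul_eq_mul, one_div]
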